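/- arXiv:2010.06650 — 8 statements merged into one kernel-verified Lean document; each statement's English description precedes it below -/
import Mathlib

section
/- Let 𝓗 be a complex Hilbert space and D a set of bounded operators on 𝓗 such that: every element of D has operator norm 1; D is closed under composition; there is p ∈ D with p ∘ x = x ∘ p = x for all x ∈ D; and for every x ∈ D there exists y ∈ D with x ∘ y = y ∘ x = p. Then p is an orthogonal projection (p is self-adjoint and p ∘ p = p), and every x ∈ D satisfies x* ∘ x = x ∘ x* = p and x ∘ p = p ∘ x = x; in particular the inverse of x in the group D is its Hilbert-space adjoint x*. -/
open ContinuousLinearMap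

/-- A contraction `T` that preserves the norm of `v` satisfies `T† (T v) = v`. -/
theorem adjoint_apply_apply_eq_of_norm_eq {H : Type*} [NormedAddCommGroup H]
    [InnerProductSpace ℂ H] [CompleteSpace H] {T : H →L[ℂ] H} (hT : ‖T‖ ≤ 1) {v : H}
    (hv : ‖T v‖ = ‖v‖) : adjoint T (T v) = v := by
  have hle : ‖adjoint T (T v)‖ ≤ ‖v‖ := by
    rw [← hv]
    exact (adjoint T).le_of_opNorm_le (by rwa [LinearIsometryEquiv.norm_map]) _ |>.trans
      (one_mul _).le
  have hsq : ‖adjoint T (T v) - v‖ ^ 2 = ‖adjoint T (T v)‖ ^ 2 - 2 * ‖T v‖ ^ 2 + ‖v‖ ^ 2 := by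
    rw [@norm_sub_sq ℂ, adjoint_inner_left, inner_self_eq_norm_sq]
  have hzero : ‖adjoint T (T v) - v‖ ^ 2 ≤ 0 := by
    rw [hsq, hv]
    nlinarith [norm_nonneg (adjoint T (T v))]
  exact sub_eq_zero.mp (norm_eq_zero.mp (pow_eq_zero_iff two_ne_zero |>.mp
    (hzero.antisymm (sq_nonneg _))))

/-- If contractions `x`, `y` satisfy `y ∘ x = p` and `x ∘ p = x`, then `x† ∘ x = p`. -/
theorem adjoint_comp_self_eq_of_comp_eq {H : Type*} [NormedAddCommGroup H]
    [InnerProductSpace ℂ H] [CompleteSpace H] {x y p : H →L[ℂ] H} (hx : ‖x‖ ≤ 1)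
    (hy : ‖y‖ ≤ 1) (hxp : x ∘L p = x) (hyx : y ∘L x = p) : adjoint x ∘L x = p := by
  ext v
  have hxv : x (p v) = x v := DFunLike.congr_fun hxp v
  have hyv : y (x v) = p v := DFunLike.congr_fun hyx v
  have hnorm : ‖x (p v)‖ = ‖p v‖ := by
    refine le_antisymm ((x.le_of_opNorm_le hx _).trans (one_mul _).le) ?_
    rw [hxv, ← hyv]
    exact (y.le_of_opNorm_le hy _).trans (one_mul _).le
  simpa [hxv] using adjoint_apply_apply_eq_of_norm_eq hx hnorm

/-- If `D` is a set of norm-one bounded operators on a complex Hilbert space that is a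
group under composition with identity `p`, then `p` is an orthogonal projection and the
inverse of each `x ∈ D` is its Hilbert-space adjoint. -/
theorem stmt5 {𝓗 : Type*} [NormedAddCommGroup 𝓗] [InnerProductSpace ℂ 𝓗]
    [CompleteSpace 𝓗] (D : Set (𝓗 →L[ℂ] 𝓗))
    (hnorm : ∀ x ∈ D, ‖x‖ = 1)
    (hmul : ∀ x ∈ D, ∀ y ∈ D, x ∘L y ∈ D)
    (p : 𝓗 →L[ℂ] 𝓗) (hp : p ∈ D)
    (hid : ∀ x ∈ D, p ∘L x = x ∧ x ∘L p = x)
    (hinv : ∀ x ∈ D, ∃ y ∈ D, x ∘L y = p ∧ y ∘L x = p) :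
    (IsSelfAdjoint p ∧ p ∘L p = p) ∧
    ∀ x ∈ D, adjoint x ∘L x = p ∧ x ∘L adjoint x = p ∧
      x ∘L p = x ∧ p ∘L x = x ∧ adjoint x ∈ D := by
  have key : ∀ x ∈ D, adjoint x ∘L x = p := fun x hx ↦ by
    obtain ⟨y, hy, -, hyx⟩ := hinv x hx
    exact adjoint_comp_self_eq_of_comp_eq (hnorm x hx).le (hnorm y hy).le (hid x hx).2 hyx
  have hsa : adjoint p = p := by
    conv_lhs => rw [← key p hp]
    rw [adjoint_comp, adjoint_adjoint, key p hp]
  refine ⟨⟨isSelfAdjoint_iff'.mpr hsa, (hid p hp).1⟩, fun x hx ↦ ?_⟩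
  obtain ⟨y, hy, hxy, -⟩ := hinv x hx
  have hadj : adjoint x = y := by
    calc adjoint x = adjoint (p ∘L x) := by rw [(hid x hx).1]
      _ = adjoint x ∘L (x ∘L y) := by rw [adjoint_comp, hsa, hxy]
      _ = (adjoint x ∘L x) ∘L y := (comp_assoc _ _ _).symm
      _ = y := by rw [key x hx, (hid y hy).1]
  exact ⟨key x hx, hadj ▸ hxy, (hid x hx).2, (hid x hx).1, hadj ▸ hy⟩
end

section
/- Let A be a C*-algebra and p, q ∈ A self-adjoint idempotents with p * q = q * p. Then: (i) p * q commutes with every element of D_p and with every element of D_q if and only if p commutes with every element of D_q and q commutes with every element of D_p. (ii) If the equivalent conditions of (i) hold, then x * y ∈ D_{p*q} and y * x ∈ D_{p*q} whenever x ∈ D_p and y ∈ D_q. (iii) If p * q = q * p = q and q commutes with every element of D_p, then {x * y | x ∈ D_p, y ∈ D_q} = {y * x | y ∈ D_q, x ∈ D_p} = D_q. -/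
/-- For `p` a self-adjoint idempotent, `Dset p = {x | star x * x = p ∧ x * star x = p}`. -/
def Dset {A : Type*} [Mul A] [Star A] (p : A) : Set A :=
  {x | star x * x = p ∧ x * star x = p}

section Dset

variable {A : Type*} [NormedRing A] [StarRing A] {p q x y : A}

theorem star_mem_Dset (hx : x ∈ Dset p) : star x ∈ Dset p :=
  ⟨by rw [star_star]; exact hx.2, by rw [star_star]; exact hx.1⟩

theorem self_mem_Dset (hpsa : star p = p) (hpi : p * p = p) : p ∈ Dset p :=
  ⟨by rw [hpsa, hpi], by rw [hpsa, hpi]⟩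

theorem mul_mem_Dset_mul (hx : x ∈ Dset p) (hy : y ∈ Dset q)
    (hcomm : p * q = q * p) (hpy : p * y = y * p) (hqx : q * x = x * q) :
    x * y ∈ Dset (p * q) := by
  constructor
  · calc star (x * y) * (x * y) = star y * ((star x * x) * y) := by
          rw [star_mul]; simp only [mul_assoc]
      _ = p * q := by rw [hx.1, hpy, ← mul_assoc, hy.1, hcomm]
  · calc x * y * star (x * y) = x * (y * star y) * star x := by
          rw [star_mul]; simp only [mul_assoc]
      _ = p * q := by rw [hy.2, ← hqx, mul_assoc, hx.2, hcomm]

variable [CStarRing A]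

theorem mul_right_of_mem_Dset (hpsa : star p = p) (hpi : p * p = p) (hx : x ∈ Dset p) :
    x * p = x := by
  have h : star (x * p - x) * (x * p - x) = 0 := by
    have e : star (x * p - x) * (x * p - x) =
        p * (star x * x) * p - p * (star x * x) - (star x * x) * p + star x * x := by
      rw [star_sub, star_mul, hpsa]
      noncomm_ring
    rw [e, hx.1, hpi, hpi]
    abel
  exact sub_eq_zero.mp (CStarRing.star_mul_self_eq_zero_iff _ |>.mp h)

theorem mul_left_of_mem_Dset (hpsa : star p = p) (hpi : p * p = p) (hx : x ∈ Dset p) :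
    p * x = x := by
  have h := congrArg star (mul_right_of_mem_Dset hpsa hpi (star_mem_Dset hx))
  rwa [star_mul, star_star, hpsa] at h

theorem mul_commute_iff_of_mem_Dset (hpsa : star p = p) (hpi : p * p = p)
    (hcomm : p * q = q * p) (hx : x ∈ Dset p) :
    (p * q) * x = x * (p * q) ↔ q * x = x * q := by
  rw [← mul_assoc x p q, mul_right_of_mem_Dset hpsa hpi hx, hcomm, mul_assoc,
    mul_left_of_mem_Dset hpsa hpi hx]

end Dset

/-- Interaction between the groups `D_p` and `D_q` for commuting self-adjoint
idempotents `p` and `q`. -/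
theorem stmt6 {A : Type*} [NormedRing A] [StarRing A] [CStarRing A] [CompleteSpace A]
    [NormedAlgebra ℂ A] [StarModule ℂ A]
    (p q : A) (hpsa : star p = p) (hpi : p * p = p)
    (hqsa : star q = q) (hqi : q * q = q) (hcomm : p * q = q * p) :
    (((∀ x ∈ Dset p, (p * q) * x = x * (p * q)) ∧
        (∀ y ∈ Dset q, (p * q) * y = y * (p * q))) ↔
      ((∀ y ∈ Dset q, p * y = y * p) ∧ (∀ x ∈ Dset p, q * x = x * q))) ∧
    (((∀ y ∈ Dset q, p * y = y * p) ∧ (∀ x ∈ Dset p, q * x = x * q)) →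
      ∀ x ∈ Dset p, ∀ y ∈ Dset q, x * y ∈ Dset (p * q) ∧ y * x ∈ Dset (p * q)) ∧
    ((p * q = q ∧ q * p = q ∧ (∀ x ∈ Dset p, q * x = x * q)) →
      Set.image2 (· * ·) (Dset p) (Dset q) = Dset q ∧
      Set.image2 (· * ·) (Dset q) (Dset p) = Dset q) := by
  have hi : ((∀ x ∈ Dset p, (p * q) * x = x * (p * q)) ∧
        (∀ y ∈ Dset q, (p * q) * y = y * (p * q))) ↔
      ((∀ y ∈ Dset q, p * y = y * p) ∧ (∀ x ∈ Dset p, q * x = x * q)) := by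
    rw [and_comm]
    refine and_congr (forall₂_congr fun y hy => ?_) (forall₂_congr fun x hx => ?_)
    · rw [hcomm]
      exact mul_commute_iff_of_mem_Dset hqsa hqi hcomm.symm hy
    · exact mul_commute_iff_of_mem_Dset hpsa hpi hcomm hx
  have hii : ((∀ y ∈ Dset q, p * y = y * p) ∧ (∀ x ∈ Dset p, q * x = x * q)) →
      ∀ x ∈ Dset p, ∀ y ∈ Dset q, x * y ∈ Dset (p * q) ∧ y * x ∈ Dset (p * q) := by
    rintro ⟨hp, hq⟩ x hx y hy
    refine ⟨mul_mem_Dset_mul hx hy hcomm (hp y hy) (hq x hx), ?_⟩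
    rw [hcomm]
    exact mul_mem_Dset_mul hy hx hcomm.symm (hq x hx) (hp y hy)
  refine ⟨hi, hii, ?_⟩
  rintro ⟨hpq, hqp, hq⟩
  have hpy : ∀ y ∈ Dset q, p * y = y := fun y hy => by
    rw [← mul_left_of_mem_Dset hqsa hqi hy, ← mul_assoc, hpq]
  have hyp : ∀ y ∈ Dset q, y * p = y := fun y hy => by
    rw [← mul_right_of_mem_Dset hqsa hqi hy, mul_assoc, hqp]
  have hmem := hii ⟨fun y hy => (hpy y hy).trans (hyp y hy).symm, hq⟩
  rw [hpq] at hmem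
  have hp := self_mem_Dset hpsa hpi
  constructor
  · refine Set.Subset.antisymm (Set.image2_subset_iff.mpr fun x hx y hy => (hmem x hx y hy).1) ?_
    exact fun y hy => ⟨p, hp, y, hy, hpy y hy⟩
  · refine Set.Subset.antisymm (Set.image2_subset_iff.mpr fun y hy x hx => (hmem x hx y hy).2) ?_
    exact fun y hy => ⟨y, hy, p, hp, hyp y hy⟩
end

section
/- Let A be a C*-algebra and p₁, …, pₙ a compatible chain of self-adjoint idempotents in A. Let L = D_{p₁} ∪ … ∪ D_{pₙ} and, for 1 ≤ k ≤ n, L_k = D_{p_k} ∪ … ∪ D_{pₙ}. Then: each pᵢ commutes with every element of L; L is closed under multiplication and p₁ * x = x * p₁ = x for every x ∈ L; and x * y ∈ L_k and y * x ∈ L_k whenever x ∈ L and y ∈ L_k. -/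
theorem mul_eq_self_of_mem_Dset {A : Type*} [NormedRing A] [StarRing A] [CStarRing A] {p x : A}
    (hs : star p = p) (hp : p * p = p) (hx : x ∈ Dset p) : p * x = x ∧ x * p = x := by
  obtain ⟨h, h'⟩ := hx
  have right : x * p = x := by
    rw [← sub_eq_zero, ← CStarRing.star_mul_self_eq_zero_iff]
    simp only [star_sub, star_mul, hs, sub_mul, mul_sub]
    simp only [mul_assoc, h, hp]
    simp only [← mul_assoc, h, hp, sub_self]
  refine ⟨?_, right⟩
  rw [← h', mul_assoc, h, right]

theorem self_mem_Dset_s7 {A : Type*} [Mul A] [Star A] {p : A} (hs : star p = p) (hp : p * p = p) :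
    p ∈ Dset p := by
  simp [Dset, hs, hp]

theorem mul_mem_Dset {A : Type*} [NormedRing A] [StarRing A] [CStarRing A] {p q x y : A}
    (hs : star q = q) (hq : q * q = q) (hpq : p * q = q) (hqp : q * p = q)
    (hx : x ∈ Dset p) (hy : y ∈ Dset q) (hc : q * x = x * q) :
    x * y ∈ Dset q ∧ y * x ∈ Dset q := by
  obtain ⟨hqy, hyq⟩ := mul_eq_self_of_mem_Dset hs hq hy
  obtain ⟨hx, hx'⟩ := hx
  obtain ⟨hy, hy'⟩ := hy
  have hpy : p * y = y := by rw [← hqy, ← mul_assoc, hpq]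
  have hyp : y * p = y := by rw [← hyq, mul_assoc, hqp]
  refine ⟨⟨?_, ?_⟩, ⟨?_, ?_⟩⟩
  · rw [star_mul, mul_assoc, ← mul_assoc (star x), hx, hpy, hy]
  · rw [star_mul, mul_assoc, ← mul_assoc y, hy', ← mul_assoc, ← hc, mul_assoc, hx', hqp]
  · rw [star_mul, mul_assoc, ← mul_assoc (star y), hy, hc, ← mul_assoc, hx, hpq]
  · rw [star_mul, mul_assoc, ← mul_assoc x, hx', ← mul_assoc, hyp, hy']

theorem chain_mul_eq_right {A : Type*} [Semigroup A] {n : ℕ} {p : ℕ → A}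
    (hp : ∀ i, 1 ≤ i → i ≤ n → p i * p i = p i)
    (hchain : ∀ i, 1 ≤ i → i < n → p i * p (i + 1) = p (i + 1) ∧ p (i + 1) * p i = p (i + 1))
    {i j : ℕ} (hi : 1 ≤ i) (hij : i ≤ j) (hj : j ≤ n) :
    p i * p j = p j ∧ p j * p i = p j := by
  induction j, hij using Nat.le_induction with
  | base => exact ⟨hp i hi hj, hp i hi hj⟩
  | succ j hij ih =>
    obtain ⟨h₁, h₂⟩ := ih (by lia)
    obtain ⟨h₃, h₄⟩ := hchain j (by lia) (by lia)
    exact ⟨by rw [← h₃, ← mul_assoc, h₁], by rw [← h₄, mul_assoc, h₂]⟩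

theorem chain_commute_of_mem_Dset {A : Type*} [NormedRing A] [StarRing A] [CStarRing A]
    {n : ℕ} {p : ℕ → A}
    (hsa : ∀ i, 1 ≤ i → i ≤ n → star (p i) = p i ∧ p i * p i = p i)
    (hchain : ∀ i, 1 ≤ i → i < n → p i * p (i + 1) = p (i + 1) ∧ p (i + 1) * p i = p (i + 1))
    (hcomm : ∀ i, 1 ≤ i → i < n → ∀ x ∈ Dset (p i), p (i + 1) * x = x * p (i + 1))
    {i j : ℕ} (hi : 1 ≤ i) (hij : i ≤ j) (hj : j ≤ n) {x : A} (hx : x ∈ Dset (p i)) :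
    p j * x = x * p j := by
  induction j, hij using Nat.le_induction with
  | base =>
    obtain ⟨h₁, h₂⟩ := mul_eq_self_of_mem_Dset (hsa i hi hj).1 (hsa i hi hj).2 hx
    rw [h₁, h₂]
  | succ j hij ih =>
    have hjn : j ≤ n := by lia
    obtain ⟨hs, hp⟩ := hsa j (by lia) hjn
    obtain ⟨h₁, h₂⟩ := chain_mul_eq_right (fun i h h' ↦ (hsa i h h').2) hchain hi hij hjn
    obtain ⟨h₃, h₄⟩ := hchain j (by lia) (by lia)
    have hmem := (mul_mem_Dset hs hp h₁ h₂ hx (self_mem_Dset_s7 hs hp) (ih hjn)).2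
    have hc := hcomm j (by lia) (by lia) _ hmem
    rw [← mul_assoc, h₄] at hc
    rw [hc, ih hjn, mul_assoc, h₃]

/-- For a compatible chain `p 1, …, p n` of self-adjoint idempotents:
each `p i` commutes with every element of `L = D_{p 1} ∪ ⋯ ∪ D_{p n}`, `L` is closed under
multiplication with `p 1` as a two-sided identity, and each `L k = D_{p k} ∪ ⋯ ∪ D_{p n}`
is a two-sided ideal of `L`. -/
theorem stmt7 {A : Type*} [NormedRing A] [StarRing A] [CStarRing A] [CompleteSpace A]
    [NormedAlgebra ℂ A] [StarModule ℂ A]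
    (n : ℕ) (hn : 1 ≤ n) (p : ℕ → A)
    (hsa : ∀ i, 1 ≤ i → i ≤ n → star (p i) = p i ∧ p i * p i = p i)
    (hchain : ∀ i, 1 ≤ i → i < n →
      p i * p (i + 1) = p (i + 1) ∧ p (i + 1) * p i = p (i + 1))
    (hcomm : ∀ i, 1 ≤ i → i < n → ∀ x ∈ Dset (p i), p (i + 1) * x = x * p (i + 1))
    (L : Set A) (hL : L = {x | ∃ i, 1 ≤ i ∧ i ≤ n ∧ x ∈ Dset (p i)})
    (Lk : ℕ → Set A) (hLk : ∀ k, Lk k = {x | ∃ i, k ≤ i ∧ i ≤ n ∧ x ∈ Dset (p i)}) :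
    (∀ i, 1 ≤ i → i ≤ n → ∀ x ∈ L, p i * x = x * p i) ∧
    (∀ x ∈ L, ∀ y ∈ L, x * y ∈ L) ∧
    (∀ x ∈ L, p 1 * x = x ∧ x * p 1 = x) ∧
    (∀ k, 1 ≤ k → k ≤ n → ∀ x ∈ L, ∀ y ∈ Lk k, x * y ∈ Lk k ∧ y * x ∈ Lk k) := by
  have hmul {i j : ℕ} (hi : 1 ≤ i) (hij : i ≤ j) (hj : j ≤ n) :=
    chain_mul_eq_right (fun i h h' ↦ (hsa i h h').2) hchain hi hij hj
  have hone {i : ℕ} (hi : 1 ≤ i) (hin : i ≤ n) {x : A} (hx : x ∈ Dset (p i)) :=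
    mul_eq_self_of_mem_Dset (hsa i hi hin).1 (hsa i hi hin).2 hx
  have hunit {i j : ℕ} (hi : 1 ≤ i) (hij : i ≤ j) (hj : j ≤ n) {x : A} (hx : x ∈ Dset (p j)) :
      p i * x = x ∧ x * p i = x := by
    obtain ⟨h₁, h₂⟩ := hmul hi hij hj
    obtain ⟨h₃, h₄⟩ := hone (by lia) hj hx
    exact ⟨by rw [← h₃, ← mul_assoc, h₁], by rw [← h₄, mul_assoc, h₂]⟩
  have hD {i j : ℕ} (hi : 1 ≤ i) (hij : i ≤ j) (hj : j ≤ n) {x y : A} (hx : x ∈ Dset (p i))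
      (hy : y ∈ Dset (p j)) : x * y ∈ Dset (p j) ∧ y * x ∈ Dset (p j) :=
    mul_mem_Dset (hsa j (by lia) hj).1 (hsa j (by lia) hj).2 (hmul hi hij hj).1 (hmul hi hij hj).2
      hx hy (chain_commute_of_mem_Dset hsa hchain hcomm hi hij hj hx)
  have hideal (k : ℕ) (hk : 1 ≤ k) : ∀ x ∈ L, ∀ y ∈ Lk k, x * y ∈ Lk k ∧ y * x ∈ Lk k := by
    rw [hL, hLk]
    rintro x ⟨i, hi, hin, hx⟩ y ⟨j, hkj, hjn, hy⟩
    rcases le_total i j with hij | hji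
    · obtain ⟨h₁, h₂⟩ := hD hi hij hjn hx hy
      exact ⟨⟨j, hkj, hjn, h₁⟩, ⟨j, hkj, hjn, h₂⟩⟩
    · obtain ⟨h₁, h₂⟩ := hD (hk.trans hkj) hji hin hy hx
      exact ⟨⟨i, hkj.trans hji, hin, h₂⟩, ⟨i, hkj.trans hji, hin, h₁⟩⟩
  have hL1 : L = Lk 1 := by rw [hL, hLk]
  refine ⟨?_, fun x hx y hy ↦ hL1 ▸ (hideal 1 le_rfl x hx y (hL1 ▸ hy)).1, ?_,
    fun k hk _ ↦ hideal k hk⟩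
  · rw [hL]
    rintro j hj hjn x ⟨i, hi, hin, hx⟩
    rcases le_total i j with hij | hji
    · exact chain_commute_of_mem_Dset hsa hchain hcomm hi hij hjn hx
    · obtain ⟨h₁, h₂⟩ := hunit hj hji hin hx
      rw [h₁, h₂]
  · rw [hL]
    rintro x ⟨i, hi, hin, hx⟩
    exact hunit le_rfl hi hin hx
end

section
/- Let 𝓗 be a complex Hilbert space and S a set of bounded operators on 𝓗, closed under composition, all of whose elements have operator norm 1, and such that every x ∈ S belongs to some subset D ⊆ S that is a group under composition (D is closed under composition, contains an element acting as a two-sided identity on D, and every element of D has a two-sided inverse in D relative to that identity). Then: (a) for every x ∈ S there is a unique orthogonal projection p belonging to S with x* ∘ x = x ∘ x* = p; consequently S is the disjoint union, over its idempotent elements p, of the sets D_p(S) = {x ∈ S | x* ∘ x = x ∘ x* = p}. (b) If moreover every idempotent element of S commutes with every element of S, then x ∈ D_p(S) and y ∈ D_q(S) imply x ∘ y ∈ D_{p∘q}(S). -/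
open ContinuousLinearMap

/-- If a contraction `a` has a contraction `b` undoing it on the range of `e`, then it is
isometric there. -/
theorem adjoint_mul_mul_eq_of_mul_mul_eq {𝕜 E : Type*} [RCLike 𝕜] [NormedAddCommGroup E]
    [InnerProductSpace 𝕜 E] [CompleteSpace E] {a b e : E →L[𝕜] E} (ha : ‖a‖ ≤ 1)
    (hb : ‖b‖ ≤ 1) (h : b * a * e = e) : adjoint a * a * e = e := by
  ext v
  have hu : b (a (e v)) = e v := DFunLike.congr_fun h v
  change adjoint a (a (e v)) = e v
  generalize e v = u at hu ⊢
  have hle : ‖u‖ ≤ ‖a u‖ := by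
    simpa [hu] using b.le_of_opNorm_le hb (a u)
  have hadj : ‖adjoint a (a u)‖ ≤ ‖a u‖ := by
    have h := (adjoint a).le_of_opNorm_le (by simpa using ha) (a u)
    rwa [one_mul] at h
  have hexp := norm_sub_sq (𝕜 := 𝕜) (adjoint a (a u)) u
  rw [adjoint_inner_left, inner_self_eq_norm_sq] at hexp
  have hzero : ‖adjoint a (a u) - u‖ ^ 2 ≤ 0 := by
    nlinarith [norm_nonneg u, norm_nonneg (a u), norm_nonneg (adjoint a (a u))]
  exact sub_eq_zero.1 (norm_eq_zero.1 (pow_eq_zero_iff two_ne_zero |>.1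
    (le_antisymm hzero (sq_nonneg _))))

/-- An idempotent contraction on a Hilbert space is self-adjoint. -/
theorem isSelfAdjoint_of_mul_self_eq_of_norm_le_one {𝕜 E : Type*} [RCLike 𝕜]
    [NormedAddCommGroup E] [InnerProductSpace 𝕜 E] [CompleteSpace E] {e : E →L[𝕜] E}
    (he : ‖e‖ ≤ 1) (hee : e * e = e) : IsSelfAdjoint e := by
  have h := adjoint_mul_mul_eq_of_mul_mul_eq he he (e := e) (by rw [hee, hee])
  rw [mul_assoc, hee] at h
  rw [← h, ← star_eq_adjoint]
  exact IsSelfAdjoint.star_mul_self e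

/-- In a group of contractions with identity `e`, the adjoint is the group inverse. -/
theorem adjoint_mul_self_and_mul_adjoint_self_eq {𝕜 E : Type*} [RCLike 𝕜]
    [NormedAddCommGroup E] [InnerProductSpace 𝕜 E] [CompleteSpace E] {x y e : E →L[𝕜] E}
    (hx : ‖x‖ ≤ 1) (hy : ‖y‖ ≤ 1) (he : IsSelfAdjoint e) (hee : e * e = e)
    (hex : e * x = x) (hxe : x * e = x) (hey : e * y = y) (hxy : x * y = e)
    (hyx : y * x = e) : adjoint x * x = e ∧ x * adjoint x = e := by
  have h : adjoint x * x = e := by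
    simpa [mul_assoc, hxe] using
      adjoint_mul_mul_eq_of_mul_mul_eq hx hy (e := e) (by rw [hyx, hee])
  have hadj : adjoint x = y := by
    calc adjoint x = adjoint x * e := by
          rw [← star_eq_adjoint]
          conv_rhs => rw [← he.star_eq, ← star_mul, hex]
      _ = y := by rw [← hxy, ← mul_assoc, h, hey]
  exact ⟨h, hadj.symm ▸ hxy⟩

/-- A semigroup of norm-one operators on a Hilbert space, each of whose elements lies in
a subgroup, is the disjoint union of the sets `D_p(S)` over its idempotents `p`; if the
idempotents of `S` are central, the union is graded: `D_p(S) ∘ D_q(S) ⊆ D_{p∘q}(S)`. -/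
theorem stmt8 {𝓗 : Type*} [NormedAddCommGroup 𝓗] [InnerProductSpace ℂ 𝓗]
    [CompleteSpace 𝓗] (S : Set (𝓗 →L[ℂ] 𝓗))
    (hmul : ∀ x ∈ S, ∀ y ∈ S, x * y ∈ S)
    (hnorm : ∀ x ∈ S, ‖x‖ = 1)
    (hgrp : ∀ x ∈ S, ∃ D ⊆ S, x ∈ D ∧ (∀ a ∈ D, ∀ b ∈ D, a * b ∈ D) ∧
      ∃ e ∈ D, (∀ a ∈ D, e * a = a ∧ a * e = a) ∧
        (∀ a ∈ D, ∃ b ∈ D, a * b = e ∧ b * a = e)) :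
    ((∀ x ∈ S, ∃! q : 𝓗 →L[ℂ] 𝓗,
        q ∈ S ∧ IsSelfAdjoint q ∧ q * q = q ∧ adjoint x * x = q ∧ x * adjoint x = q) ∧
      (S = ⋃ q ∈ {q ∈ S | q * q = q},
        {x ∈ S | adjoint x * x = q ∧ x * adjoint x = q}) ∧
      (∀ q ∈ S, ∀ q' ∈ S, q * q = q → q' * q' = q' → q ≠ q' →
        {x ∈ S | adjoint x * x = q ∧ x * adjoint x = q} ∩
          {x ∈ S | adjoint x * x = q' ∧ x * adjoint x = q'} = ∅)) ∧
    ((∀ q ∈ S, q * q = q → ∀ x ∈ S, q * x = x * q) →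
      ∀ q ∈ S, ∀ q' ∈ S, q * q = q → q' * q' = q' →
      ∀ x ∈ {x ∈ S | adjoint x * x = q ∧ x * adjoint x = q},
      ∀ y ∈ {y ∈ S | adjoint y * y = q' ∧ y * adjoint y = q'},
        x * y ∈ {z ∈ S | adjoint z * z = q * q' ∧ z * adjoint z = q * q'}) := by
  have key : ∀ x ∈ S, ∃ q ∈ S, IsSelfAdjoint q ∧ q * q = q ∧
      adjoint x * x = q ∧ x * adjoint x = q := by
    intro x hx
    obtain ⟨D, hDS, hxD, -, e, heD, hid, hinv⟩ := hgrp x hx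
    obtain ⟨y, hyD, hxy, hyx⟩ := hinv x hxD
    have hee := (hid e heD).1
    have he := isSelfAdjoint_of_mul_self_eq_of_norm_le_one (hnorm e (hDS heD)).le hee
    exact ⟨e, hDS heD, he, hee, adjoint_mul_self_and_mul_adjoint_self_eq (hnorm x hx).le
      (hnorm y (hDS hyD)).le he hee (hid x hxD).1 (hid x hxD).2 (hid y hyD).1 hxy hyx⟩
  refine ⟨⟨fun x hx => ?_, ?_, ?_⟩, ?_⟩
  · obtain ⟨q, hq⟩ := key x hx
    exact ⟨q, hq, fun r hr => hr.2.2.2.1.symm.trans hq.2.2.2.1⟩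
  · ext x
    simp only [Set.mem_iUnion, Set.mem_ofPred_eq, exists_prop]
    constructor
    · intro hx
      obtain ⟨q, hqS, -, hqq, h⟩ := key x hx
      exact ⟨q, ⟨hqS, hqq⟩, hx, h⟩
    · rintro ⟨_, _, hx, _⟩
      exact hx
  · intro q _ q' _ _ _ hne
    ext x
    simp only [Set.mem_inter_iff, Set.mem_ofPred_eq, Set.mem_empty_iff_false, iff_false]
    rintro ⟨⟨_, h, _⟩, _, h', _⟩
    exact hne (h.symm.trans h')
  · rintro hcomm q hq q' hq' hqq hqq' x ⟨hx, hx1, hx2⟩ y ⟨hy, hy1, hy2⟩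
    have hqsa := isSelfAdjoint_of_mul_self_eq_of_norm_le_one (hnorm q hq).le hqq
    rw [← star_eq_adjoint] at hx1 hx2 hy1 hy2
    refine ⟨hmul x hx y hy, ?_, ?_⟩
    · have hqy : star y * q = q * star y := by
        simpa [hqsa.star_eq] using congr_arg star (hcomm q hq hqq y hy)
      calc star (x * y) * (x * y) = star y * (star x * x) * y := by
            simp only [star_mul, mul_assoc]
        _ = q * q' := by rw [hx1, hqy, mul_assoc, hy1]
    · calc x * y * star (x * y) = x * (y * star y) * star x := by
            simp only [star_mul, mul_assoc]
        _ = q' * q := by rw [hy2, ← hcomm q' hq' hqq' x hx, mul_assoc, hx2]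
        _ = q * q' := hcomm q' hq' hqq' q hq
end

section
/- Let A be a C*-algebra, p₁, …, pₙ a compatible chain of self-adjoint idempotents in A, H a group with subgroups H₁ ≤ H₂ ≤ … ≤ Hₙ, and β : Hₙ → A a map with β(h k) = β(h) * β(k) for all h, k ∈ Hₙ and β(Hₙ) ⊆ D_{p₁}. Define βᵢ : Hᵢ → A by βᵢ(h) = pᵢ * β(h). Then (H₁ ≤ … ≤ Hₙ, β₁, …, βₙ) is a compatible system of homomorphisms for p₁, …, pₙ: βᵢ(Hᵢ) ⊆ D_{pᵢ}, βᵢ(h k) = βᵢ(h) * βᵢ(k) for all h, k ∈ Hᵢ, and βᵢ₊₁(h) = pᵢ₊₁ * βᵢ(h) for all h ∈ Hᵢ. -/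
section StarSemigroup

variable {A : Type*} [Semigroup A] [StarMul A] {p q x : A}

theorem Dset.commute (hx : x ∈ Dset p) : Commute p x := by
  calc p * x = x * star x * x := by rw [hx.2]
    _ = x * p := by rw [mul_assoc, hx.1]

theorem Dset.mul_mem (hx : x ∈ Dset p) (hq : IsStarProjection q) (hqp : q * p = q)
    (hqx : Commute q x) : q * x ∈ Dset q := by
  have hsq : star q = q := hq.isSelfAdjoint
  have hqq : q * q = q := hq.isIdempotentElem
  have hsp : star p = p := by rw [← hx.1, star_mul, star_star]
  have hpq : p * q = q := by simpa [hsq, hsp] using congrArg star hqp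
  constructor
  · calc star (q * x) * (q * x) = star x * ((q * q) * x) := by simp only [star_mul, hsq, mul_assoc]
      _ = star x * x * q := by rw [hqq, hqx.eq, mul_assoc]
      _ = q := by rw [hx.1, hpq]
  · calc q * x * star (q * x) = q * (x * star x) * q := by simp only [star_mul, hsq, mul_assoc]
      _ = q := by rw [hx.2, hqp, hqq]

/-- Along a compatible chain, every element of `Dset (p 1)` commutes with each `p i` and is
cut down by it into `Dset (p i)`. -/
theorem Dset.commute_and_mul_mem_of_chain {n : ℕ} {p : ℕ → A}
    (hproj : ∀ i, 1 ≤ i → i ≤ n → IsStarProjection (p i))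
    (hchain : ∀ i, 1 ≤ i → i < n →
      p i * p (i + 1) = p (i + 1) ∧ p (i + 1) * p i = p (i + 1))
    (hcomm : ∀ i, 1 ≤ i → i < n → ∀ x ∈ Dset (p i), p (i + 1) * x = x * p (i + 1))
    (hx : x ∈ Dset (p 1)) {i : ℕ} (hi : 1 ≤ i) (hin : i ≤ n) :
    Commute (p i) x ∧ p i * x ∈ Dset (p i) := by
  induction i, hi using Nat.le_induction with
  | base =>
    have h := hproj 1 le_rfl hin
    exact ⟨Dset.commute hx, Dset.mul_mem hx h h.isIdempotentElem (Dset.commute hx)⟩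
  | succ i hi ih =>
    obtain ⟨hcx, hmem⟩ := ih (by lia)
    obtain ⟨hpq, hqp⟩ := hchain i hi hin
    have hqx := hcomm i hi hin _ hmem
    have hcut : p (i + 1) * (p i * x) = p (i + 1) * x := by rw [← mul_assoc, hqp]
    refine ⟨?_, hcut ▸ Dset.mul_mem hmem (hproj _ (by lia) hin) hqp hqx⟩
    calc p (i + 1) * x = p i * x * p (i + 1) := by rw [← hcut, hqx]
      _ = x * p (i + 1) := by rw [hcx.eq, mul_assoc, hpq]

end StarSemigroup

/-- Given a compatible chain `p 1, …, p n` of self-adjoint idempotents, a chain of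
subgroups `H 1 ≤ ⋯ ≤ H n` and a homomorphism `β` of `H n` into `D_{p 1}`, the maps
`βᵢ(h) = p i * β h` form a compatible system of homomorphisms for `p 1, …, p n`. -/
theorem stmt9 {A : Type*} [NormedRing A] [StarRing A] [CStarRing A] [CompleteSpace A]
    [NormedAlgebra ℂ A] [StarModule ℂ A] {H : Type*} [Group H]
    (n : ℕ) (hn : 1 ≤ n) (p : ℕ → A)
    (hsa : ∀ i, 1 ≤ i → i ≤ n → star (p i) = p i ∧ p i * p i = p i)
    (hchain : ∀ i, 1 ≤ i → i < n →
      p i * p (i + 1) = p (i + 1) ∧ p (i + 1) * p i = p (i + 1))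
    (hcomm : ∀ i, 1 ≤ i → i < n → ∀ x ∈ Dset (p i), p (i + 1) * x = x * p (i + 1))
    (Hsub : ℕ → Subgroup H)
    (hHchain : ∀ i, 1 ≤ i → i < n → Hsub i ≤ Hsub (i + 1))
    (β : H → A)
    (hβmul : ∀ h ∈ Hsub n, ∀ k ∈ Hsub n, β (h * k) = β h * β k)
    (hβmem : ∀ h ∈ Hsub n, β h ∈ Dset (p 1)) :
    (∀ i, 1 ≤ i → i ≤ n → ∀ h ∈ Hsub i, p i * β h ∈ Dset (p i)) ∧
    (∀ i, 1 ≤ i → i ≤ n → ∀ h ∈ Hsub i, ∀ k ∈ Hsub i,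
      p i * β (h * k) = (p i * β h) * (p i * β k)) ∧
    (∀ i, 1 ≤ i → i < n → ∀ h ∈ Hsub i,
      p (i + 1) * β h = p (i + 1) * (p i * β h)) := by
  have hproj : ∀ i, 1 ≤ i → i ≤ n → IsStarProjection (p i) := fun i hi hin =>
    ⟨(hsa i hi hin).2, (hsa i hi hin).1⟩
  have hle : ∀ i, 1 ≤ i → i ≤ n → Hsub i ≤ Hsub n := fun i hi hin => by
    induction hin using Nat.decreasingInduction with
    | self => exact le_rfl
    | of_succ k hk ih => exact (hHchain k hi hk).trans (ih (by lia))
  have key : ∀ i, 1 ≤ i → i ≤ n → ∀ h ∈ Hsub i,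
      Commute (p i) (β h) ∧ p i * β h ∈ Dset (p i) := fun i hi hin h hh =>
    Dset.commute_and_mul_mem_of_chain hproj hchain hcomm (hβmem h (hle i hi hin hh)) hi hin
  refine ⟨fun i hi hin h hh => (key i hi hin h hh).2, fun i hi hin h hh k hk => ?_,
    fun i hi hin h _ => by rw [← mul_assoc, (hchain i hi hin).2]⟩
  rw [hβmul h (hle i hi hin hh) k (hle i hi hin hk), ← mul_assoc, (key i hi hin h hh).1.eq,
    mul_assoc, mul_assoc, ← mul_assoc (p i) (p i), (hsa i hi hin).2]
end

section
/- Assume hypotheses (H1)–(H3). Let q ∈ A be a self-adjoint idempotent and y ∈ H with α(y) ∈ D_q. Then: (i) p * q = q * p = q, and for every k ∈ H_p one has α(y k) * star α(y k) = q and star α(k y) * α(k y) = q. (ii) If moreover y H_p = H_p y (equality of subsets of H), or q * α(k) = α(k) * q for every k ∈ H_p, then α(y k) ∈ D_q and α(k y) ∈ D_q for every k ∈ H_p. -/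
/-- Under hypotheses (H1)–(H3): if `α y ∈ D_q`, then `q ≤ p`, `α` maps `y H_p` into
`{x | x * star x = q}` and `H_p y` into `{x | star x * x = q}`; if moreover
`y H_p = H_p y` or `q` commutes with `α(H_p)`, then `α(y H_p ∪ H_p y) ⊆ D_q`. -/
theorem stmt10 {A : Type*} [NormedRing A] [StarRing A] [CStarRing A] [CompleteSpace A]
    [NormedAlgebra ℂ A] [StarModule ℂ A] {H : Type*} [Group H]
    (α : H → A) (p : A) (hpsa : star p = p) (hpi : p * p = p)
    (Hp : Set H)
    (hHp : Hp = {k : H | star (α k) * α k = p ∧ α k * star (α k) = p})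
    (hH1 : α 1 = p)
    (hH2 : ∀ h : H, α h⁻¹ = star (α h))
    (hH3 : ∀ h : H, ∀ k ∈ Hp, α (h * k) = α h * α k ∧ α (k * h) = α k * α h)
    (q : A) (hqsa : star q = q) (hqi : q * q = q)
    (y : H) (hy : α y ∈ Dset q) :
    (p * q = q ∧ q * p = q ∧
      ∀ k ∈ Hp, α (y * k) * star (α (y * k)) = q ∧
        star (α (k * y)) * α (k * y) = q) ∧
    (((fun k => y * k) '' Hp = (fun k => k * y) '' Hp ∨
        ∀ k ∈ Hp, q * α k = α k * q) →
      ∀ k ∈ Hp, α (y * k) ∈ Dset q ∧ α (k * y) ∈ Dset q) := by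
  obtain ⟨hy₁, hy₂⟩ := hy
  have hmem : ∀ k ∈ Hp, star (α k) * α k = p ∧ α k * star (α k) = p := by
    intro k hk
    rwa [hHp] at hk
  have h_one : (1 : H) ∈ Hp := by
    rw [hHp]
    simp [hH1, hpsa, hpi]
  have hyp : α y * p = α y := by
    simpa [hH1] using (hH3 y 1 h_one).1.symm
  have hpy : p * α y = α y := by
    simpa [hH1] using (hH3 y 1 h_one).2.symm
  have hpq : p * q = q := by
    rw [← hy₂, ← mul_assoc, hpy]
  have hqp : q * p = q := by
    rw [← hy₁, mul_assoc, hyp]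
  have h_right : ∀ k ∈ Hp, α (y * k) * star (α (y * k)) = q := by
    intro k hk
    calc α (y * k) * star (α (y * k))
        = α y * (α k * star (α k)) * star (α y) := by
          rw [(hH3 y k hk).1, star_mul]; simp only [mul_assoc]
      _ = q := by rw [(hmem k hk).2, hyp, hy₂]
  have h_left : ∀ k ∈ Hp, star (α (k * y)) * α (k * y) = q := by
    intro k hk
    calc star (α (k * y)) * α (k * y)
        = star (α y) * ((star (α k) * α k) * α y) := by
          rw [(hH3 y k hk).2, star_mul]; simp only [mul_assoc]
      _ = q := by rw [(hmem k hk).1, hpy, hy₁]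
  refine ⟨⟨hpq, hqp, fun k hk => ⟨h_right k hk, h_left k hk⟩⟩, ?_⟩
  rintro (hcoset | hcomm) k hk
  · obtain ⟨l, hl, hly⟩ : y * k ∈ (fun k => k * y) '' Hp := hcoset ▸ ⟨k, hk, rfl⟩
    obtain ⟨m, hm, hym⟩ : k * y ∈ (fun k => y * k) '' Hp := hcoset ▸ ⟨k, hk, rfl⟩
    refine ⟨⟨?_, h_right k hk⟩, ⟨h_left k hk, ?_⟩⟩
    · rw [← hly]
      exact h_left l hl
    · rw [← hym]
      exact h_right m hm
  · refine ⟨⟨?_, h_right k hk⟩, ⟨h_left k hk, ?_⟩⟩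
    · calc star (α (y * k)) * α (y * k)
          = star (α k) * ((star (α y) * α y) * α k) := by
            rw [(hH3 y k hk).1, star_mul]; simp only [mul_assoc]
        _ = q := by rw [hy₁, hcomm k hk, ← mul_assoc, (hmem k hk).1, hpq]
    · calc α (k * y) * star (α (k * y))
          = α k * (α y * star (α y)) * star (α k) := by
            rw [(hH3 y k hk).2, star_mul]; simp only [mul_assoc]
        _ = q := by rw [hy₂, ← hcomm k hk, mul_assoc, (hmem k hk).2, hqp]
end

section
/- Assume hypotheses (H1)–(H3). Let q ∈ A be a self-adjoint idempotent; put α_q(h) = q * α(h) * q and H_q = {h ∈ H | α_q(h) ∈ D_q}. If there exists y_q ∈ H such that α(y_q k) ∈ D_q for every k ∈ H_p, then H_p ⊆ H_q, and for every y ∈ H with α(y) ∈ D_q and every k ∈ H_p, both α(y k) ∈ D_q and α(k y) ∈ D_q. -/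
/-- Under hypotheses (H1)–(H3): if `α (y_q * k) ∈ D_q` for every `k ∈ H_p`, then
`H_p ⊆ H_q`, and for every `y` with `α y ∈ D_q` one has `α(y H_p ∪ H_p y) ⊆ D_q`. -/
theorem stmt11 {A : Type*} [NormedRing A] [StarRing A] [CStarRing A] [CompleteSpace A]
    [NormedAlgebra ℂ A] [StarModule ℂ A] {H : Type*} [Group H]
    (α : H → A) (p : A) (hpsa : star p = p) (hpi : p * p = p)
    (Hp : Set H)
    (hHp : Hp = {k : H | star (α k) * α k = p ∧ α k * star (α k) = p})
    (hH1 : α 1 = p)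
    (hH2 : ∀ h : H, α h⁻¹ = star (α h))
    (hH3 : ∀ h : H, ∀ k ∈ Hp, α (h * k) = α h * α k ∧ α (k * h) = α k * α h)
    (q : A) (hqsa : star q = q) (hqi : q * q = q)
    (αq : H → A) (hαq : ∀ h, αq h = q * α h * q)
    (Hq : Set H) (hHq : Hq = {h : H | αq h ∈ Dset q})
    (yq : H) (hyq : ∀ k ∈ Hp, α (yq * k) ∈ Dset q) :
    Hp ⊆ Hq ∧
    ∀ y : H, α y ∈ Dset q → ∀ k ∈ Hp,
      α (y * k) ∈ Dset q ∧ α (k * y) ∈ Dset q := by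
  subst hHp
  have one_mem : (1 : H) ∈ {k : H | star (α k) * α k = p ∧ α k * star (α k) = p} := by
    simp [hH1, hpsa, hpi]
  have mul_p (h : H) : α h * p = α h := by
    simpa [hH1] using (hH3 h 1 one_mem).1.symm
  have p_mul (h : H) : p * α h = α h := by
    simpa [hH1] using (hH3 h 1 one_mem).2.symm
  obtain ⟨hx, -⟩ : α yq ∈ Dset q := by simpa using hyq 1 one_mem
  have p_mul_q : p * q = q := by
    rw [← hx, ← mul_assoc, ← hH2, p_mul]
  have q_mul_p : q * p = q := by
    rw [← hx, mul_assoc, mul_p]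
  -- the values of `α` on `H_p` fix `q` under conjugation, in both directions
  have key (k : H) (hk : k ∈ {k : H | star (α k) * α k = p ∧ α k * star (α k) = p}) :
      star (α k) * q * α k = q ∧ α k * q = q * α k ∧ α k * q * star (α k) = q := by
    have h1 : star (α k) * q * α k = q := by
      have h := (hyq k hk).1
      rw [(hH3 yq k hk).1, star_mul] at h
      rwa [mul_assoc, ← mul_assoc (star (α yq)), hx, ← mul_assoc] at h
    have h2 : α k * q = q * α k := by
      calc α k * q = α k * (star (α k) * q * α k) := by rw [h1]
        _ = (α k * star (α k)) * q * α k := by simp only [mul_assoc]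
        _ = q * α k := by rw [hk.2, p_mul_q]
    exact ⟨h1, h2, by rw [h2, mul_assoc, hk.2, q_mul_p]⟩
  refine ⟨fun k hk => ?_, fun y hy k hk => ?_⟩
  · obtain ⟨h1, h2, h3⟩ := key k hk
    have hc : q * α k * q = α k * q := by rw [← h2, mul_assoc, hqi]
    have hs : star (α k * q) = q * star (α k) := by rw [star_mul, hqsa]
    rw [hHq, Set.mem_ofPred_eq, hαq, hc]
    refine ⟨?_, ?_⟩
    · rw [hs, h2, mul_assoc, ← mul_assoc (star (α k)), h1, hqi]
    · rw [hs, mul_assoc, ← mul_assoc q, hqi, ← mul_assoc, h3]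
  · obtain ⟨h1, -, h3⟩ := key k hk
    obtain ⟨hy1, hy2⟩ := hy
    rw [(hH3 y k hk).1, (hH3 y k hk).2]
    refine ⟨⟨?_, ?_⟩, ⟨?_, ?_⟩⟩
    · rw [star_mul, mul_assoc, ← mul_assoc (star (α y)), hy1, ← mul_assoc, h1]
    · rw [star_mul, mul_assoc, ← mul_assoc (α k), hk.2, ← mul_assoc, mul_p, hy2]
    · rw [star_mul, mul_assoc, ← mul_assoc (star (α k)), hk.1, p_mul, hy1]
    · rw [star_mul, mul_assoc, ← mul_assoc (α y), hy2, ← mul_assoc, h3]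
end

section
/- Let A be a C*-algebra, p₁, …, pₙ a compatible chain of self-adjoint idempotents in A, H a group, and (E₁ ⊆ … ⊆ Eₙ, α₁, …, αₙ) a compatible system of affine maps for p₁, …, pₙ with fusion map α : Eₙ → A. Fix y₀ ∈ E₁ and put x₀ = α₁(y₀). Then x₀ ∈ D_{p₁}; each Hᵢ := y₀⁻¹ Eᵢ is a subgroup of H and H₁ ≤ H₂ ≤ … ≤ Hₙ; the maps βᵢ : Hᵢ → A defined by βᵢ(h) = star x₀ * αᵢ(y₀ h) form a compatible system of homomorphisms for p₁, …, pₙ; and α(y) = x₀ * γ(y₀⁻¹ y) for every y ∈ Eₙ, where γ is the fusion map of (β₁, …, βₙ). -/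
namespace Dset

theorem star_mem {A : Type*} [Mul A] [InvolutiveStar A] {p a : A} (ha : a ∈ Dset p) :
    star a ∈ Dset p :=
  ⟨by simpa using ha.2, by simpa using ha.1⟩

variable {A : Type*} [NonUnitalNormedRing A] [StarRing A] [CStarRing A] {p a b : A}

theorem mul_right (hs : star p = p) (hp : p * p = p) (ha : a ∈ Dset p) : a * p = a := by
  have h : star (a - a * p) * (a - a * p) = 0 := by
    have e : star (a - a * p) * (a - a * p) =
        star a * a - star a * a * p - p * (star a * a) + p * (star a * a) * p := by
      rw [star_sub, star_mul, hs]
      noncomm_ring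
    rw [e, ha.1, hp, hp]
    simp
  exact (sub_eq_zero.mp (CStarRing.star_mul_self_eq_zero_iff _ |>.mp h)).symm

theorem mul_left (hs : star p = p) (hp : p * p = p) (ha : a ∈ Dset p) : p * a = a := by
  have h := congrArg star (mul_right hs hp (star_mem ha))
  simpa [hs] using h

theorem mul_mem_s16 (hs : star p = p) (hp : p * p = p) (ha : a ∈ Dset p) (hb : b ∈ Dset p) :
    a * b ∈ Dset p := by
  constructor
  · rw [star_mul, mul_assoc, ← mul_assoc (star a), ha.1, mul_left hs hp hb, hb.1]
  · rw [star_mul, mul_assoc, ← mul_assoc b, hb.2, mul_left hs hp (star_mem ha), ha.2]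

end Dset

/-- From a compatible system of affine maps `(E 1 ⊆ ⋯ ⊆ E n, α 1, …, α n)` for a
compatible chain `p 1, …, p n`, fixing `y₀ ∈ E 1` and putting `x₀ = α 1 y₀`, the sets
`Hs i = y₀⁻¹ (E i)` are a chain of subgroups and the maps
`β i h = star x₀ * α i (y₀ h)` form a compatible system of homomorphisms, whose fusion
map `γ` satisfies `α y = x₀ * γ (y₀⁻¹ y)` on `E n`. -/
theorem stmt16 {A : Type*} [NormedRing A] [StarRing A] [CStarRing A] [CompleteSpace A]
    [NormedAlgebra ℂ A] [StarModule ℂ A] {H : Type*} [Group H]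
    (n : ℕ) (hn : 1 ≤ n) (p : ℕ → A)
    (hsa : ∀ i, 1 ≤ i → i ≤ n → star (p i) = p i ∧ p i * p i = p i)
    (hchain : ∀ i, 1 ≤ i → i < n →
      p i * p (i + 1) = p (i + 1) ∧ p (i + 1) * p i = p (i + 1))
    (hcomm : ∀ i, 1 ≤ i → i < n → ∀ x ∈ Dset (p i), p (i + 1) * x = x * p (i + 1))
    (E : ℕ → Set H) (α : ℕ → H → A)
    (hEne : ∀ i, 1 ≤ i → i ≤ n → (E i).Nonempty)
    (hEchain : ∀ i, 1 ≤ i → i < n → E i ⊆ E (i + 1))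
    (hEcoset : ∀ i, 1 ≤ i → i ≤ n → ∀ x ∈ E i, ∀ y ∈ E i, ∀ z ∈ E i,
      x * y⁻¹ * z ∈ E i)
    (hαmem : ∀ i, 1 ≤ i → i ≤ n → ∀ x ∈ E i, α i x ∈ Dset (p i))
    (hαaff : ∀ i, 1 ≤ i → i ≤ n → ∀ x ∈ E i, ∀ y ∈ E i, ∀ z ∈ E i,
      α i (x * y⁻¹ * z) = α i x * star (α i y) * α i z)
    (hαstep : ∀ i, 1 ≤ i → i < n → ∀ h ∈ E i, α (i + 1) h = p (i + 1) * α i h)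
    (y₀ : H) (hy₀ : y₀ ∈ E 1) (x₀ : A) (hx₀ : x₀ = α 1 y₀)
    (Hs : ℕ → Set H) (hHs : ∀ i, Hs i = {h : H | y₀ * h ∈ E i})
    (β : ℕ → H → A) (hβ : ∀ i h, β i h = star x₀ * α i (y₀ * h)) :
    x₀ ∈ Dset (p 1) ∧
    (∀ i, 1 ≤ i → i ≤ n → (1 : H) ∈ Hs i ∧
      (∀ h ∈ Hs i, ∀ k ∈ Hs i, h * k ∈ Hs i) ∧ (∀ h ∈ Hs i, h⁻¹ ∈ Hs i)) ∧
    (∀ i, 1 ≤ i → i < n → Hs i ⊆ Hs (i + 1)) ∧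
    (∀ i, 1 ≤ i → i ≤ n → ∀ h ∈ Hs i, β i h ∈ Dset (p i)) ∧
    (∀ i, 1 ≤ i → i ≤ n → ∀ h ∈ Hs i, ∀ k ∈ Hs i,
      β i (h * k) = β i h * β i k) ∧
    (∀ i, 1 ≤ i → i < n → ∀ h ∈ Hs i, β (i + 1) h = p (i + 1) * β i h) ∧
    (∀ k, 1 ≤ k → k ≤ n → ∀ y ∈ E k, (k = 1 ∨ y ∉ E (k - 1)) →
      y₀⁻¹ * y ∈ Hs k ∧ (k = 1 ∨ y₀⁻¹ * y ∉ Hs (k - 1)) ∧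
      α k y = x₀ * β k (y₀⁻¹ * y)) := by
  have hyE : ∀ i, 1 ≤ i → i ≤ n → y₀ ∈ E i := by
    intro i hi
    induction i, hi using Nat.le_induction with
    | base => exact fun _ => hy₀
    | succ i hi ih => exact fun hin => hEchain i hi hin (ih (by omega))
  have hq : ∀ i, 1 ≤ i → i ≤ n → p i * x₀ = α i y₀ ∧ x₀ * p i = α i y₀ := by
    intro i hi
    induction i, hi using Nat.le_induction with
    | base =>
      intro h
      have hm := hαmem 1 le_rfl h y₀ hy₀
      obtain ⟨hs, hp⟩ := hsa 1 le_rfl h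
      rw [hx₀]
      exact ⟨Dset.mul_left hs hp hm, Dset.mul_right hs hp hm⟩
    | succ i hi ih =>
      intro hin
      obtain ⟨hl, hr⟩ := ih (by omega)
      have hm := hyE i hi (by omega)
      obtain ⟨hc, hc'⟩ := hchain i hi hin
      have hstep := hαstep i hi hin y₀ hm
      constructor
      · rw [hstep, ← hl, ← mul_assoc, hc']
      · rw [hstep, hcomm i hi hin _ (hαmem i hi (by omega) y₀ hm), ← hr, mul_assoc, hc]
  have hβq : ∀ i, 1 ≤ i → i ≤ n → ∀ h ∈ Hs i, β i h = star (α i y₀) * α i (y₀ * h) := by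
    intro i hi hin h hh
    rw [hHs] at hh
    obtain ⟨hs, hp⟩ := hsa i hi hin
    rw [hβ, ← (hq i hi hin).1, star_mul, hs, mul_assoc,
      Dset.mul_left hs hp (hαmem i hi hin _ hh)]
  have hmul : ∀ i, 1 ≤ i → i ≤ n → ∀ h ∈ Hs i, ∀ k ∈ Hs i, h * k ∈ Hs i := by
    intro i hi hin h hh k hk
    rw [hHs] at *
    simpa [mul_assoc] using hEcoset i hi hin _ hh _ (hyE i hi hin) _ hk
  refine ⟨hx₀ ▸ hαmem 1 le_rfl hn y₀ hy₀, ?_, ?_, ?_, ?_, ?_, ?_⟩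
  · refine fun i hi hin => ⟨?_, hmul i hi hin, fun h hh => ?_⟩
    · simpa [hHs] using hyE i hi hin
    · rw [hHs] at *
      simpa [mul_assoc] using hEcoset i hi hin _ (hyE i hi hin) _ hh _ (hyE i hi hin)
  · intro i hi hin h hh
    rw [hHs] at *
    exact hEchain i hi hin hh
  · intro i hi hin h hh
    rw [hβq i hi hin h hh]
    rw [hHs] at hh
    obtain ⟨hs, hp⟩ := hsa i hi hin
    exact Dset.mul_mem_s16 hs hp (Dset.star_mem (hαmem i hi hin _ (hyE i hi hin)))
      (hαmem i hi hin _ hh)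
  · intro i hi hin h hh k hk
    rw [hβq i hi hin _ (hmul i hi hin h hh k hk), hβq i hi hin h hh, hβq i hi hin k hk]
    rw [hHs] at hh hk
    have e : y₀ * (h * k) = y₀ * h * y₀⁻¹ * (y₀ * k) := by group
    rw [e, hαaff i hi hin _ hh _ (hyE i hi hin) _ hk]
    simp only [mul_assoc]
  · intro i hi hin h hh
    rw [hHs] at hh
    obtain ⟨hl, hr⟩ := hq (i + 1) (by omega) hin
    have hc := congrArg star (hl.trans hr.symm)
    rw [star_mul, star_mul, (hsa (i + 1) (by omega) hin).1] at hc
    rw [hβ, hβ, hαstep i hi hin _ hh, ← mul_assoc, hc, mul_assoc]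
  · intro k hk hkn y hy hy'
    have hyk : y₀⁻¹ * y ∈ Hs k := by simpa [hHs] using hy
    refine ⟨hyk, by simpa [hHs] using hy', ?_⟩
    obtain ⟨hs, hp⟩ := hsa k hk hkn
    have hm := hαmem k hk hkn y₀ (hyE k hk hkn)
    rw [hβq k hk hkn _ hyk, mul_inv_cancel_left, ← Dset.mul_left hs hp (Dset.star_mem hm),
      ← mul_assoc, ← mul_assoc, (hq k hk hkn).2, hm.2,
      Dset.mul_left hs hp (hαmem k hk hkn y hy)]
end
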